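/- arXiv:1810.08278 — 3 statements merged into one kernel-verified Lean document; each statement's English description precedes it below -/
import Mathlib

section
/- Let α and β be Borel probability measures on X, and assume the Gibbs kernel k_ε is strictly positive definite. Then the Sinkhorn divergence is nonnegative: S_ε(α, β) ≥ 0. -/
open MeasureTheory Real Filter Topology
open scoped NNReal ENNReal

/-- The entropic dual functional `D_ε(α, β; f, g)`. -/
noncomputable def Dfun {X : Type*} [MeasurableSpace X] (eps : ℝ) (C : X → X → ℝ)
    (alpha beta : Measure X) (f g : X → ℝ) : ℝ :=
  (∫ x, f x ∂alpha) + (∫ y, g y ∂beta) -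
    eps * ∫ x, ∫ y, (Real.exp ((f x + g y - C x y) / eps) - 1) ∂beta ∂alpha

/-- The entropic transport cost `OT_ε(α, β)`, as a supremum of the dual
functional over pairs of continuous potentials. -/
noncomputable def OTcost {X : Type*} [TopologicalSpace X] [MeasurableSpace X] (eps : ℝ) (C : X → X → ℝ)
    (alpha beta : Measure X) : ℝ :=
  sSup {r : ℝ | ∃ f g : X → ℝ, Continuous f ∧ Continuous g ∧ r = Dfun eps C alpha beta f g}

/-- The Sinkhorn divergence `S_ε(α, β)`. -/
noncomputable def Sinkhorn {X : Type*} [TopologicalSpace X] [MeasurableSpace X] (eps : ℝ) (C : X → X → ℝ)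
    (alpha beta : Measure X) : ℝ :=
  OTcost eps C alpha beta - (1/2) * OTcost eps C alpha alpha - (1/2) * OTcost eps C beta beta

/-- The squared kernel norm `‖ξ‖²_k = ∫∫ k dξ dξ` of the finite signed measure
`ξ = μ - ν`, written out in terms of its positive and negative parts. -/
noncomputable def kerQuad {X : Type*} [MeasurableSpace X] (k : X → X → ℝ)
    (mu nu : Measure X) : ℝ :=
  ∫ x, ∫ y, k x y ∂mu ∂mu - ∫ x, ∫ y, k x y ∂nu ∂mu
    - ∫ x, ∫ y, k x y ∂mu ∂nu + ∫ x, ∫ y, k x y ∂nu ∂nu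

/-- A kernel is strictly positive definite if `‖ξ‖²_k > 0` for every nonzero
finite signed Borel measure `ξ = μ - ν`. -/
def StrictPosDef {X : Type*} [MeasurableSpace X] (k : X → X → ℝ) : Prop :=
  ∀ mu nu : Measure X, IsFiniteMeasure mu → IsFiniteMeasure nu → mu ≠ nu →
    0 < kerQuad k mu nu

section Helpers

variable {X : Type*} [MetricSpace X]

lemma continuous_uncurry_of_lipschitz {C : X → X → ℝ} {kappa : ℝ≥0}
    (hClip1 : ∀ y, LipschitzWith kappa (fun x => C x y))
    (hClip2 : ∀ x, LipschitzWith kappa (fun y => C x y)) :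
    Continuous fun p : X × X => C p.1 p.2 :=
  (LipschitzWith.uncurry hClip1 hClip2).continuous

/-- The total mass `∫∫ exp ((f ⊕ g - C) / ε) dα dβ` of the Gibbs plan with potentials `f`, `g`. -/
noncomputable def gibbsMass {Y : Type*} [MeasurableSpace Y] (eps : ℝ) (C : Y → Y → ℝ)
    (alpha beta : Measure Y) (f g : Y → ℝ) : ℝ :=
  ∫ x, ∫ y, Real.exp ((f x + g y - C x y) / eps) ∂beta ∂alpha

/-- The measure `exp (f / ε) α`. -/
noncomputable def expTilt {Y : Type*} [MeasurableSpace Y] (eps : ℝ) (f : Y → ℝ)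
    (alpha : Measure Y) : Measure Y :=
  alpha.withDensity fun x => ((Real.exp (f x / eps)).toNNReal : ℝ≥0∞)

variable {eps : ℝ} {C : X → X → ℝ} {f g : X → ℝ}

lemma continuous_gibbs (hC : Continuous fun p : X × X => C p.1 p.2)
    (hf : Continuous f) (hg : Continuous g) :
    Continuous fun p : X × X => Real.exp ((f p.1 + g p.2 - C p.1 p.2) / eps) := by
  fun_prop

variable [MeasurableSpace X] [BorelSpace X]

lemma integral_expTilt (hf : Continuous f) (alpha : Measure X) (h : X → ℝ) :
    ∫ x, h x ∂(expTilt eps f alpha) = ∫ x, Real.exp (f x / eps) * h x ∂alpha := by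
  have hm : Measurable fun x => (Real.exp (f x / eps)).toNNReal := by
    have : Continuous fun x => (Real.exp (f x / eps)).toNNReal := by fun_prop
    exact this.measurable
  rw [expTilt, integral_withDensity_eq_integral_smul hm]
  simp [NNReal.smul_def, Real.exp_nonneg]

lemma integral_kernel_expTilt (hf : Continuous f) (hg : Continuous g) (alpha beta : Measure X) :
    ∫ x, ∫ y, Real.exp (-(C x y) / eps) ∂(expTilt eps g beta) ∂(expTilt eps f alpha) =
      gibbsMass eps C alpha beta f g := by
  rw [integral_expTilt hf, gibbsMass]
  refine integral_congr_ae (.of_forall fun x => ?_)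
  simp only
  rw [integral_expTilt hg, ← integral_const_mul]
  refine integral_congr_ae (.of_forall fun y => ?_)
  simp only
  rw [← Real.exp_add, ← Real.exp_add]
  ring_nf

variable [CompactSpace X]

lemma Continuous.integrable_of_compactSpace {Y : Type*} [TopologicalSpace Y] [CompactSpace Y]
    [MeasurableSpace Y] [OpensMeasurableSpace Y] {f : Y → ℝ} (hf : Continuous f)
    (mu : Measure Y) [IsFiniteMeasure mu] : Integrable f mu :=
  hf.integrable_of_hasCompactSupport (HasCompactSupport.of_compactSpace f)

lemma gibbsMass_eq_integral_prod (hC : Continuous fun p : X × X => C p.1 p.2)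
    (hf : Continuous f) (hg : Continuous g) (alpha beta : Measure X)
    [IsFiniteMeasure alpha] [IsFiniteMeasure beta] :
    gibbsMass eps C alpha beta f g =
      ∫ p, Real.exp ((f p.1 + g p.2 - C p.1 p.2) / eps) ∂(alpha.prod beta) :=
  (integral_prod _ ((continuous_gibbs hC hf hg).integrable_of_compactSpace _)).symm

lemma gibbsMass_swap (hC : Continuous fun p : X × X => C p.1 p.2) (hCsym : ∀ x y, C x y = C y x)
    (hf : Continuous f) (hg : Continuous g) (alpha beta : Measure X)
    [IsFiniteMeasure alpha] [IsFiniteMeasure beta] :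
    gibbsMass eps C alpha beta f g = gibbsMass eps C beta alpha g f := by
  unfold gibbsMass
  rw [integral_integral_swap ((continuous_gibbs hC hf hg).integrable_of_compactSpace _)]
  simp only [hCsym, add_comm (f _)]

lemma Dfun_eq_gibbsMass (hC : Continuous fun p : X × X => C p.1 p.2)
    (hf : Continuous f) (hg : Continuous g) (alpha beta : Measure X)
    [IsProbabilityMeasure alpha] [IsProbabilityMeasure beta] :
    Dfun eps C alpha beta f g =
      ∫ x, f x ∂alpha + ∫ y, g y ∂beta - eps * (gibbsMass eps C alpha beta f g - 1) := by
  have h := continuous_gibbs (eps := eps) hC hf hg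
  rw [gibbsMass_eq_integral_prod hC hf hg, Dfun,
    ← integral_prod (fun p : X × X => Real.exp ((f p.1 + g p.2 - C p.1 p.2) / eps) - 1)
      ((h.sub continuous_const).integrable_of_compactSpace _),
    integral_sub (h.integrable_of_compactSpace _) (integrable_const _)]
  simp

lemma Dfun_le_integral_cost (heps : 0 < eps) (hC : Continuous fun p : X × X => C p.1 p.2)
    (hf : Continuous f) (hg : Continuous g) (alpha beta : Measure X)
    [IsProbabilityMeasure alpha] [IsProbabilityMeasure beta] :
    Dfun eps C alpha beta f g ≤ ∫ p, C p.1 p.2 ∂(alpha.prod beta) := by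
  have h := (continuous_gibbs (eps := eps) hC hf hg).integrable_of_compactSpace (alpha.prod beta)
  have hf' : Integrable (fun p : X × X => f p.1) (alpha.prod beta) :=
    (hf.comp continuous_fst).integrable_of_compactSpace _
  have hg' : Integrable (fun p : X × X => g p.2) (alpha.prod beta) :=
    (hg.comp continuous_snd).integrable_of_compactSpace _
  have hC' := hC.integrable_of_compactSpace (alpha.prod beta)
  have hfi : ∫ p, f p.1 ∂(alpha.prod beta) = ∫ x, f x ∂alpha := by
    simp [integral_fun_fst]
  have hgi : ∫ p, g p.2 ∂(alpha.prod beta) = ∫ y, g y ∂beta := by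
    simp [integral_fun_snd]
  have key : ∫ p, (f p.1 + g p.2 - C p.1 p.2) ∂(alpha.prod beta) ≤
      ∫ p, eps * (Real.exp ((f p.1 + g p.2 - C p.1 p.2) / eps) - 1) ∂(alpha.prod beta) := by
    refine integral_mono ((hf'.add hg').sub hC') ((h.sub (integrable_const 1)).const_mul eps)
      fun p => ?_
    have := mul_le_mul_of_nonneg_left
      (Real.add_one_le_exp ((f p.1 + g p.2 - C p.1 p.2) / eps)) heps.le
    rw [mul_add, mul_div_cancel₀ _ heps.ne'] at this
    simp only
    linarith
  rw [integral_const_mul, integral_sub h (integrable_const _), integral_sub (by exact hf'.add hg') hC',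
    integral_add hf' hg'] at key
  simp only [hfi, hgi, integral_const, probReal_univ, smul_eq_mul,
    mul_one] at key
  rw [Dfun_eq_gibbsMass hC hf hg, gibbsMass_eq_integral_prod hC hf hg]
  linarith

lemma Dfun_le_OTcost (heps : 0 < eps) (hC : Continuous fun p : X × X => C p.1 p.2)
    (hf : Continuous f) (hg : Continuous g) (alpha beta : Measure X)
    [IsProbabilityMeasure alpha] [IsProbabilityMeasure beta] :
    Dfun eps C alpha beta f g ≤ OTcost eps C alpha beta := by
  refine le_csSup ⟨∫ p, C p.1 p.2 ∂(alpha.prod beta), ?_⟩ ⟨f, g, hf, hg, rfl⟩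
  rintro _ ⟨f', g', hf', hg', rfl⟩
  exact Dfun_le_integral_cost heps hC hf' hg' alpha beta

lemma gibbsMass_midpoint_le (hC : Continuous fun p : X × X => C p.1 p.2)
    (hCsym : ∀ x y, C x y = C y x) (hf : Continuous f) (hg : Continuous g) (alpha : Measure X)
    [IsFiniteMeasure alpha] :
    gibbsMass eps C alpha alpha (fun x => (f x + g x) / 2) (fun x => (f x + g x) / 2) ≤
      gibbsMass eps C alpha alpha f g := by
  have hm : Continuous fun x => (f x + g x) / 2 := by fun_prop
  have hfg := (continuous_gibbs (eps := eps) hC hf hg).integrable_of_compactSpace (alpha.prod alpha)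
  have hgf := (continuous_gibbs (eps := eps) hC hg hf).integrable_of_compactSpace (alpha.prod alpha)
  have key : gibbsMass eps C alpha alpha (fun x => (f x + g x) / 2) (fun x => (f x + g x) / 2) ≤
      (gibbsMass eps C alpha alpha f g + gibbsMass eps C alpha alpha g f) / 2 := by
    rw [gibbsMass_eq_integral_prod hC hm hm, gibbsMass_eq_integral_prod hC hf hg,
      gibbsMass_eq_integral_prod hC hg hf, ← integral_add hfg hgf, ← integral_div]
    refine integral_mono ((continuous_gibbs hC hm hm).integrable_of_compactSpace _)
      ((hfg.add hgf).div_const 2) fun p => ?_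
    set a := (f p.1 + g p.2 - C p.1 p.2) / eps
    set b := (g p.1 + f p.2 - C p.1 p.2) / eps
    have hab : ((f p.1 + g p.1) / 2 + (f p.2 + g p.2) / 2 - C p.1 p.2) / eps = a / 2 + b / 2 := by
      simp only [a, b]
      ring
    have ha : Real.exp a = Real.exp (a / 2) ^ 2 := by rw [← Real.exp_nat_mul]; ring_nf
    have hb : Real.exp b = Real.exp (b / 2) ^ 2 := by rw [← Real.exp_nat_mul]; ring_nf
    simp only [hab, Real.exp_add, ha, hb]
    nlinarith [sq_nonneg (Real.exp (a / 2) - Real.exp (b / 2))]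
  rw [gibbsMass_swap hC hCsym hg hf] at key
  linarith

lemma Dfun_le_Dfun_midpoint (heps : 0 < eps) (hC : Continuous fun p : X × X => C p.1 p.2)
    (hCsym : ∀ x y, C x y = C y x) (hf : Continuous f) (hg : Continuous g) (alpha : Measure X)
    [IsProbabilityMeasure alpha] :
    Dfun eps C alpha alpha f g ≤
      Dfun eps C alpha alpha (fun x => (f x + g x) / 2) (fun x => (f x + g x) / 2) := by
  have hm : Continuous fun x => (f x + g x) / 2 := by fun_prop
  rw [Dfun_eq_gibbsMass hC hf hg, Dfun_eq_gibbsMass hC hm hm, integral_div,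
    integral_add (hf.integrable_of_compactSpace _) (hg.integrable_of_compactSpace _)]
  have := mul_le_mul_of_nonneg_left (gibbsMass_midpoint_le (eps := eps) hC hCsym hf hg alpha)
    heps.le
  linarith

lemma isFiniteMeasure_expTilt (hf : Continuous f) (alpha : Measure X) [IsFiniteMeasure alpha] :
    IsFiniteMeasure (expTilt eps f alpha) := by
  have h : Continuous fun x => Real.exp (f x / eps) := by fun_prop
  exact isFiniteMeasure_withDensity_ofReal (h.integrable_of_compactSpace alpha).2

lemma kerQuad_nonneg {Y : Type*} [MeasurableSpace Y] {k : Y → Y → ℝ} (hk : StrictPosDef k)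
    (mu nu : Measure Y) [IsFiniteMeasure mu] [IsFiniteMeasure nu] : 0 ≤ kerQuad k mu nu := by
  by_cases h : mu = nu
  · subst h
    simp [kerQuad]
  · exact (hk mu nu inferInstance inferInstance h).le

lemma two_mul_gibbsMass_le (hC : Continuous fun p : X × X => C p.1 p.2)
    (hCsym : ∀ x y, C x y = C y x)
    (hpd : StrictPosDef (fun x y => Real.exp (-(C x y) / eps)))
    (hf : Continuous f) (hg : Continuous g) (alpha beta : Measure X)
    [IsFiniteMeasure alpha] [IsFiniteMeasure beta] :
    2 * gibbsMass eps C alpha beta f g ≤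
      gibbsMass eps C alpha alpha f f + gibbsMass eps C beta beta g g := by
  have := isFiniteMeasure_expTilt (eps := eps) hf alpha
  have := isFiniteMeasure_expTilt (eps := eps) hg beta
  have h := kerQuad_nonneg hpd (expTilt eps f alpha) (expTilt eps g beta)
  rw [kerQuad, integral_kernel_expTilt hf hf, integral_kernel_expTilt hf hg,
    integral_kernel_expTilt hg hf, integral_kernel_expTilt hg hg,
    gibbsMass_swap hC hCsym hg hf] at h
  linarith

lemma half_Dfun_add_half_Dfun_le (heps : 0 < eps) (hC : Continuous fun p : X × X => C p.1 p.2)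
    (hCsym : ∀ x y, C x y = C y x)
    (hpd : StrictPosDef (fun x y => Real.exp (-(C x y) / eps)))
    (hf : Continuous f) (hg : Continuous g) (alpha beta : Measure X)
    [IsProbabilityMeasure alpha] [IsProbabilityMeasure beta] :
    (1 / 2) * Dfun eps C alpha alpha f f + (1 / 2) * Dfun eps C beta beta g g ≤
      Dfun eps C alpha beta f g := by
  rw [Dfun_eq_gibbsMass hC hf hf, Dfun_eq_gibbsMass hC hg hg, Dfun_eq_gibbsMass hC hf hg]
  have := mul_le_mul_of_nonneg_left (two_mul_gibbsMass_le hC hCsym hpd hf hg alpha beta) heps.le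
  linarith

lemma OTcost_le_of_forall_Dfun_le {Y : Type*} [TopologicalSpace Y] [MeasurableSpace Y]
    {eps : ℝ} {C : Y → Y → ℝ} {alpha beta : Measure Y} {B : ℝ}
    (h : ∀ f g, Continuous f → Continuous g → Dfun eps C alpha beta f g ≤ B) :
    OTcost eps C alpha beta ≤ B := by
  refine csSup_le ⟨_, 0, 0, continuous_const, continuous_const, rfl⟩ ?_
  rintro _ ⟨f, g, hf, hg, rfl⟩
  exact h f g hf hg

end Helpers

/-- If the Gibbs kernel `k_ε` is strictly positive definite, the
Sinkhorn divergence between Borel probability measures is nonnegative. -/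
theorem sinkhorn_nonneg
    {X : Type*} [MetricSpace X] [CompactSpace X] [MeasurableSpace X] [BorelSpace X]
    (eps : ℝ) (heps : 0 < eps) (C : X → X → ℝ) (kappa : ℝ≥0) (hkappa : 0 < kappa)
    (hCsym : ∀ x y, C x y = C y x)
    (hClip1 : ∀ y, LipschitzWith kappa (fun x => C x y))
    (hClip2 : ∀ x, LipschitzWith kappa (fun y => C x y))
    (hpd : StrictPosDef (fun x y => Real.exp (-(C x y) / eps)))
    (alpha beta : Measure X) [IsProbabilityMeasure alpha] [IsProbabilityMeasure beta] :
    0 ≤ Sinkhorn eps C alpha beta := by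
  have hC := continuous_uncurry_of_lipschitz hClip1 hClip2
  have key : ∀ f g f' g' : X → ℝ, Continuous f → Continuous g → Continuous f' → Continuous g' →
      (1 / 2) * Dfun eps C alpha alpha f g + (1 / 2) * Dfun eps C beta beta f' g' ≤
        OTcost eps C alpha beta := by
    intro f g f' g' hf hg hf' hg'
    have hm : Continuous fun x => (f x + g x) / 2 := by fun_prop
    have hm' : Continuous fun x => (f' x + g' x) / 2 := by fun_prop
    have h1 := Dfun_le_Dfun_midpoint heps hC hCsym hf hg alpha
    have h2 := Dfun_le_Dfun_midpoint heps hC hCsym hf' hg' beta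
    have h3 := half_Dfun_add_half_Dfun_le heps hC hCsym hpd hm hm' alpha beta
    have h4 := Dfun_le_OTcost heps hC hm hm' alpha beta
    linarith
  have hbeta : ∀ f g : X → ℝ, Continuous f → Continuous g →
      OTcost eps C beta beta ≤
        2 * OTcost eps C alpha beta - Dfun eps C alpha alpha f g := fun f g hf hg =>
    OTcost_le_of_forall_Dfun_le fun f' g' hf' hg' => by linarith [key f g f' g' hf hg hf' hg']
  have halpha : OTcost eps C alpha alpha ≤
      2 * OTcost eps C alpha beta - OTcost eps C beta beta :=
    OTcost_le_of_forall_Dfun_le fun f g hf hg => by linarith [hbeta f g hf hg]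
  unfold Sinkhorn
  linarith
end

section
/- Assume the Gibbs kernel k_ε is strictly positive definite. Then the Sinkhorn negentropy F_ε is strictly convex on the set of Borel probability measures on X: for all Borel probability measures α₀ ≠ α₁ on X and all t ∈ (0, 1), F_ε((1−t)α₀ + tα₁) < (1−t) F_ε(α₀) + t F_ε(α₁). -/
open MeasureTheory Real Filter Topology
open scoped NNReal ENNReal

lemma integral_integral_schrodinger {X : Type*} [MeasurableSpace X] {k : X → X → ℝ}
    {mu : Measure X} {phi : X → ℝ}
    (hfix : ∀ x, ∫ y, k x y * Real.exp (phi y) ∂mu = Real.exp (-phi x)) (u : X → ℝ) :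
    ∫ x, ∫ y, k x y * Real.exp (phi x) * Real.exp (phi y) * u x ∂mu ∂mu = ∫ x, u x ∂mu := by
  refine integral_congr_ae (.of_forall fun x => ?_)
  calc ∫ y, k x y * Real.exp (phi x) * Real.exp (phi y) * u x ∂mu
      = ∫ y, Real.exp (phi x) * u x * (k x y * Real.exp (phi y)) ∂mu :=
        integral_congr_ae (.of_forall fun y => by ring)
    _ = u x := by
        rw [integral_const_mul, hfix, mul_right_comm, ← Real.exp_add, add_neg_cancel,
          Real.exp_zero, one_mul]

lemma integral_withDensity_ofReal_exp {X : Type*} [TopologicalSpace X] [MeasurableSpace X]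
    [OpensMeasurableSpace X] {mu : Measure X} {phi : X → ℝ} (hphi : Continuous phi)
    (g : X → ℝ) :
    ∫ x, g x ∂mu.withDensity (fun x => ENNReal.ofReal (Real.exp (phi x)))
      = ∫ x, g x * Real.exp (phi x) ∂mu := by
  rw [integral_withDensity_eq_integral_toReal_smul (by fun_prop) (by simp)]
  simp only [ENNReal.toReal_ofReal (Real.exp_pos _).le, smul_eq_mul, mul_comm]

section Compact

variable {X : Type*} [MetricSpace X] [CompactSpace X] [MeasurableSpace X] [BorelSpace X]

lemma integrable_of_continuous_compactSpace {mu : Measure X} [IsFiniteMeasure mu] {f : X → ℝ}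
    (hf : Continuous f) : Integrable f mu :=
  hf.integrable_of_hasCompactSupport (HasCompactSupport.of_compactSpace _)

lemma continuous_integral_of_compactSpace {mu : Measure X} [IsFiniteMeasure mu] {f : X → X → ℝ}
    (hf : Continuous (Function.uncurry f)) : Continuous fun x => ∫ y, f x y ∂mu := by
  simpa using continuous_parametric_integral_of_continuous (μ := mu) hf isCompact_univ

lemma integral_pos_of_continuous_pos {mu : Measure X} [IsProbabilityMeasure mu] {f : X → ℝ}
    (hf : Continuous f) (hpos : ∀ x, 0 < f x) : 0 < ∫ x, f x ∂mu := by
  have h := integral_exp_pos (μ := mu) (f := fun x => Real.log (f x))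
  simp only [Real.exp_log (hpos _)] at h
  exact h (integrable_of_continuous_compactSpace hf)

/-- The logarithm of the integral operator with kernel `k` applied to `exp f`. -/
noncomputable def logKernelInt (k : X → X → ℝ) (mu : Measure X) (f : X → ℝ) (x : X) : ℝ :=
  Real.log (∫ y, k x y * Real.exp (f y) ∂mu)

section Kernel

variable {k : X → X → ℝ} {mu : Measure X} [IsProbabilityMeasure mu]

lemma kernelInt_pos (hk : Continuous (Function.uncurry k)) (hpos : ∀ x y, 0 < k x y) {f : X → ℝ}
    (hf : Continuous f) (x : X) : 0 < ∫ y, k x y * Real.exp (f y) ∂mu :=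
  integral_pos_of_continuous_pos (by fun_prop) fun y => mul_pos (hpos x y) (Real.exp_pos _)

lemma exp_logKernelInt (hk : Continuous (Function.uncurry k)) (hpos : ∀ x y, 0 < k x y)
    {f : X → ℝ} (hf : Continuous f) (x : X) :
    Real.exp (logKernelInt k mu f x) = ∫ y, k x y * Real.exp (f y) ∂mu :=
  Real.exp_log (kernelInt_pos hk hpos hf x)

lemma continuous_logKernelInt (hk : Continuous (Function.uncurry k)) (hpos : ∀ x y, 0 < k x y)
    {f : X → ℝ} (hf : Continuous f) : Continuous (logKernelInt k mu f) := by
  refine Continuous.log ?_ fun x => (kernelInt_pos hk hpos hf x).ne'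
  exact continuous_integral_of_compactSpace (f := fun x y => k x y * Real.exp (f y)) (by fun_prop)

/-- The map `logKernelInt k mu` contracts oscillations when `k` is bounded above and below. -/
lemma logKernelInt_osc_le (hk : Continuous (Function.uncurry k)) {a b : ℝ} (ha : 0 < a)
    (hka : ∀ x y, a ≤ k x y) (hkb : ∀ x y, k x y ≤ b) {f g : X → ℝ} (hf : Continuous f)
    (hg : Continuous g) {D : ℝ} (hD : ∀ x y, f x - g x - (f y - g y) ≤ D) (x x' : X) :
    logKernelInt k mu f x - logKernelInt k mu g x
      - (logKernelInt k mu f x' - logKernelInt k mu g x') ≤ (1 - (a / b) ^ 2) * D := by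
  have hpos : ∀ x y, 0 < k x y := fun x y => ha.trans_le (hka x y)
  have hab : a ≤ b := (hka x x).trans (hkb x x)
  have hb : 0 < b := ha.trans_le hab
  obtain ⟨z, -, hz⟩ := isCompact_univ.exists_isMinOn (f := fun y => f y - g y)
    ⟨x, Set.mem_univ x⟩ (hf.sub hg).continuousOn
  set m := f z - g z with hm
  have hmle : ∀ y, m ≤ f y - g y := fun y => hz (Set.mem_univ y)
  set w : X → ℝ := fun y => Real.exp (f y) - Real.exp m * Real.exp (g y) with hw
  have hwc : Continuous w := by fun_prop
  have hw0 : ∀ y, 0 ≤ w y := fun y => by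
    rw [hw, sub_nonneg, ← Real.exp_add]
    exact Real.exp_le_exp.2 (by linarith [hmle y])
  set I : (X → ℝ) → X → ℝ := fun f x => ∫ y, k x y * Real.exp (f y) ∂mu with hI
  have hIf : ∀ x, 0 < I f x := kernelInt_pos hk hpos hf
  have hIg : ∀ x, 0 < I g x := kernelInt_pos hk hpos hg
  have int1 : ∀ (x : X) {h : X → ℝ}, Continuous h → Integrable (fun y => k x y * h y) mu :=
    fun x h hh => integrable_of_continuous_compactSpace (by fun_prop)
  have hIw : ∀ x, ∫ y, k x y * w y ∂mu = I f x - Real.exp m * I g x := fun x => by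
    rw [hI, ← integral_const_mul, ← integral_sub (int1 x (by fun_prop))
      ((int1 x (by fun_prop)).const_mul _)]
    exact integral_congr_ae (.of_forall fun y => by simp only [hw]; ring)
  have hcomp : ∀ (x x' : X) {h : X → ℝ}, Continuous h → (∀ y, 0 ≤ h y) →
      a / b * ∫ y, k x y * h y ∂mu ≤ ∫ y, k x' y * h y ∂mu := fun x x' h hh h0 => by
    rw [← integral_const_mul]
    refine integral_mono ((int1 x hh).const_mul _) (int1 x' hh) fun y => ?_
    have : a / b * k x y ≤ k x' y := by
      rw [div_mul_eq_mul_div, div_le_iff₀ hb]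
      nlinarith [hka x' y, hkb x y, hpos x y]
    calc a / b * (k x y * h y) = (a / b * k x y) * h y := by ring
      _ ≤ k x' y * h y := mul_le_mul_of_nonneg_right this (h0 y)
  have hab0 : 0 < a / b := div_pos ha hb
  have hab1 : a / b ≤ 1 := (div_le_one hb).2 hab
  have hd1 : (a / b) ^ 2 ≤ 1 := pow_le_one₀ hab0.le hab1
  have hr : ∀ x, Real.exp (logKernelInt k mu f x - logKernelInt k mu g x) = I f x / I g x :=
    fun x => by rw [Real.exp_sub, exp_logKernelInt hk hpos hf, exp_logKernelInt hk hpos hg]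
  set r := logKernelInt k mu f x - logKernelInt k mu g x
  set r' := logKernelInt k mu f x' - logKernelInt k mu g x'
  have hratio : (a / b) ^ 2 * (I f x / I g x) + (1 - (a / b) ^ 2) * Real.exp m
      ≤ I f x' / I g x' := by
    have h1 := hcomp x x' hwc hw0
    have h2 : a / b * I g x' ≤ I g x :=
      hcomp x' x (h := fun y => Real.exp (g y)) (by fun_prop) fun y => (Real.exp_pos _).le
    have hwx : 0 ≤ ∫ y, k x y * w y ∂mu :=
      integral_nonneg fun y => mul_nonneg (hpos x y).le (hw0 y)
    have h3 : (a / b) ^ 2 * ((∫ y, k x y * w y ∂mu) / I g x)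
        ≤ (∫ y, k x' y * w y ∂mu) / I g x' := by
      rw [mul_div_assoc', div_le_div_iff₀ (hIg x) (hIg x')]
      calc (a / b) ^ 2 * (∫ y, k x y * w y ∂mu) * I g x'
          = (a / b * ∫ y, k x y * w y ∂mu) * (a / b * I g x') := by ring
        _ ≤ (∫ y, k x' y * w y ∂mu) * I g x :=
          mul_le_mul h1 h2 (by have := hIg x'; positivity) (le_trans (by positivity) h1)
    rw [hIw, hIw, sub_div, sub_div, mul_div_cancel_right₀ _ (hIg x).ne',
      mul_div_cancel_right₀ _ (hIg x').ne'] at h3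
    linarith
  have hupper : r ≤ m + D := by
    rw [← Real.exp_le_exp, hr, div_le_iff₀ (hIg x), hI, ← integral_const_mul]
    refine integral_mono (int1 x (by fun_prop)) ((int1 x (by fun_prop)).const_mul _) fun y => ?_
    have : Real.exp (f y) ≤ Real.exp (m + D) * Real.exp (g y) := by
      rw [← Real.exp_add]
      exact Real.exp_le_exp.2 (by linarith [hD y z])
    calc k x y * Real.exp (f y) ≤ k x y * (Real.exp (m + D) * Real.exp (g y)) :=
          mul_le_mul_of_nonneg_left this (hpos x y).le
      _ = _ := by ring
  have hlower : (a / b) ^ 2 * r + (1 - (a / b) ^ 2) * m ≤ r' := by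
    rw [← Real.exp_le_exp, hr]
    refine le_trans ?_ hratio
    rw [← hr]
    have := convexOn_exp.2 (Set.mem_univ r) (Set.mem_univ m) (sq_nonneg (a / b))
      (sub_nonneg.2 hd1) (by ring)
    simpa only [smul_eq_mul] using this
  nlinarith [mul_le_mul_of_nonneg_left hupper (sub_nonneg.2 hd1)]

/-- Existence of a symmetric Schrödinger potential for a positive continuous kernel. -/
theorem exists_schrodinger_potential (hk : Continuous (Function.uncurry k))
    (hpos : ∀ x y, 0 < k x y) (mu : Measure X) [IsProbabilityMeasure mu] :
    ∃ phi : X → ℝ, Continuous phi ∧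
      ∀ x, ∫ y, k x y * Real.exp (phi y) ∂mu = Real.exp (-phi x) := by
  obtain ⟨x0⟩ : Nonempty X := nonempty_of_isProbabilityMeasure mu
  obtain ⟨p, -, hp⟩ := isCompact_univ.exists_isMinOn (f := Function.uncurry k)
    ⟨(x0, x0), Set.mem_univ _⟩ hk.continuousOn
  obtain ⟨q, -, hq⟩ := isCompact_univ.exists_isMaxOn (f := Function.uncurry k)
    ⟨(x0, x0), Set.mem_univ _⟩ hk.continuousOn
  set a := Function.uncurry k p
  set b := Function.uncurry k q
  have ha : 0 < a := hpos _ _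
  have hka : ∀ x y, a ≤ k x y := fun x y => hp (Set.mem_univ (x, y))
  have hkb : ∀ x y, k x y ≤ b := fun x y => hq (Set.mem_univ (x, y))
  have hb : 0 < b := ha.trans_le ((hka x0 x0).trans (hkb x0 x0))
  set r := 1 - (a / b) ^ 2 with hrdef
  have hr1 : r < 1 := by
    have : 0 < (a / b) ^ 2 := by positivity
    linarith
  have hr0 : 0 ≤ r := by
    have : (a / b) ^ 2 ≤ 1 := pow_le_one₀ (by positivity)
      ((div_le_one hb).2 ((hka x0 x0).trans (hkb x0 x0)))
    linarith
  let T : C(X, ℝ) → C(X, ℝ) := fun f =>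
    ⟨fun x => logKernelInt k mu f x0 - logKernelInt k mu f x,
      continuous_const.sub (continuous_logKernelInt hk hpos f.continuous)⟩
  have hTosc : ∀ (f g : C(X, ℝ)) (D : ℝ), (∀ x y, f x - g x - (f y - g y) ≤ D) →
      ∀ x y, T f x - T g x - (T f y - T g y) ≤ r * D := fun f g D hD x y => by
    have := logKernelInt_osc_le (mu := mu) hk ha hka hkb f.continuous g.continuous hD y x
    simp only [T, ContinuousMap.coe_mk]
    linarith
  have hTx0 : ∀ f, T f x0 = 0 := fun f => by simp [T]
  have hdist : ∀ (f g : C(X, ℝ)) (D : ℝ), (∀ x y, f x - g x - (f y - g y) ≤ D) →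
      dist (T f) (T g) ≤ r * D := fun f g D hD => by
    have hD0 : 0 ≤ D := by simpa using hD x0 x0
    refine (ContinuousMap.dist_le (by positivity)).2 fun x => ?_
    have h1 := hTosc f g D hD x x0
    have h2 := hTosc f g D hD x0 x
    rw [hTx0, hTx0] at h1 h2
    rw [Real.dist_eq, abs_le]
    constructor <;> linarith
  have hosc : ∀ (f g : C(X, ℝ)) x y, f x - g x - (f y - g y) ≤ 2 * dist f g := fun f g x y => by
    have h1 := abs_le.1 (ContinuousMap.dist_apply_le_dist (f := f) (g := g) x)
    have h2 := abs_le.1 (ContinuousMap.dist_apply_le_dist (f := f) (g := g) y)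
    linarith
  have hTcont : Continuous T := by
    refine (LipschitzWith.of_dist_le_mul (K := (r * 2).toNNReal) fun f g => ?_).continuous
    rw [Real.coe_toNNReal _ (by positivity), mul_assoc]
    exact hdist f g _ (hosc f g)
  set u : ℕ → C(X, ℝ) := fun n => T^[n] 0 with hu
  have husucc : ∀ n, u (n + 1) = T (u n) := fun n => Function.iterate_succ_apply' T n 0
  set D := 2 * dist (u 0) (u 1)
  have huosc : ∀ n x y, u n x - u (n + 1) x - (u n y - u (n + 1) y) ≤ r ^ n * D := by
    intro n
    induction n with
    | zero => simpa using hosc (u 0) (u 1)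
    | succ n ih =>
      have h := hTosc _ _ _ ih
      rw [← husucc, ← husucc] at h
      intro x y
      refine (h x y).trans_eq (by ring)
  have hcauchy : CauchySeq fun n => u (n + 1) := by
    refine cauchySeq_of_le_geometric r (r * D) hr1 fun n => ?_
    rw [husucc n, husucc (n + 1)]
    exact (hdist _ _ _ (huosc n)).trans_eq (by ring)
  obtain ⟨h, hlim⟩ := cauchySeq_tendsto_of_complete hcauchy
  have hfix : T h = h := by
    have h1 : Tendsto (fun n => u (n + 1 + 1)) atTop (𝓝 (T h)) := by
      simp only [husucc (_ + 1)]
      exact (hTcont.tendsto h).comp hlim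
    exact tendsto_nhds_unique h1 (hlim.comp (tendsto_add_atTop_nat 1))
  set c := logKernelInt k mu h x0
  have hfix' : ∀ x, c - logKernelInt k mu h x = h x := fun x => DFunLike.congr_fun hfix x
  refine ⟨fun x => h x - c / 2, by fun_prop, fun x => ?_⟩
  calc ∫ y, k x y * Real.exp (h y - c / 2) ∂mu
      = ∫ y, Real.exp (-(c / 2)) * (k x y * Real.exp (h y)) ∂mu := by
        refine integral_congr_ae (.of_forall fun y => ?_)
        simp only [sub_eq_add_neg, Real.exp_add]
        ring
    _ = Real.exp (-(c / 2)) * Real.exp (logKernelInt k mu h x) := by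
        rw [integral_const_mul, exp_logKernelInt hk hpos h.continuous]
    _ = Real.exp (-(h x - c / 2)) := by
        rw [← Real.exp_add]
        congr 1
        linarith [hfix' x]

/-- Weak duality against a symmetric Schrödinger potential. -/
lemma dual_le_of_schrodinger (hk : Continuous (Function.uncurry k)) (hpos : ∀ x y, 0 < k x y)
    (hsymm : ∀ x y, k x y = k y x) {phi : X → ℝ} (hphi : Continuous phi)
    (hfix : ∀ x, ∫ y, k x y * Real.exp (phi y) ∂mu = Real.exp (-phi x))
    {u v : X → ℝ} (hu : Continuous u) (hv : Continuous v) :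
    (∫ x, u x ∂mu) + (∫ x, v x ∂mu) + 1 - 2 * ∫ x, phi x ∂mu
      ≤ ∫ x, ∫ y, k x y * Real.exp (u x + v y) ∂mu ∂mu := by
  set P : X → X → ℝ := fun x y => k x y * Real.exp (phi x) * Real.exp (phi y) with hP
  have hPc : Continuous (Function.uncurry P) := by fun_prop
  set U : X → ℝ := fun x => u x - phi x + 1
  set V : X → ℝ := fun x => v x - phi x
  have hUc : Continuous U := by fun_prop
  have hVc : Continuous V := by fun_prop
  have hU : ∫ x, ∫ y, P x y * U x ∂mu ∂mu = ∫ x, U x ∂mu :=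
    integral_integral_schrodinger hfix U
  have hV : ∫ x, ∫ y, P x y * V y ∂mu ∂mu = ∫ x, V x ∂mu := by
    rw [integral_integral_swap_of_hasCompactSupport (f := fun x y => P x y * V y) (by fun_prop)
      (HasCompactSupport.of_compactSpace _), ← integral_integral_schrodinger hfix V]
    simp only [hP]
    refine integral_congr_ae (.of_forall fun x => integral_congr_ae (.of_forall fun y => ?_))
    simp only [hsymm x y]
    ring
  have i1 : Integrable (fun x => ∫ y, P x y * U x ∂mu) mu :=
    integrable_of_continuous_compactSpace
      (continuous_integral_of_compactSpace (f := fun x y => P x y * U x) (by fun_prop))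
  have i2 : Integrable (fun x => ∫ y, P x y * V y ∂mu) mu :=
    integrable_of_continuous_compactSpace
      (continuous_integral_of_compactSpace (f := fun x y => P x y * V y) (by fun_prop))
  have hsum : (∫ x, u x ∂mu) + (∫ x, v x ∂mu) + 1 - 2 * ∫ x, phi x ∂mu
      = ∫ x, ((∫ y, P x y * U x ∂mu) + ∫ y, P x y * V y ∂mu) ∂mu := by
    have iu : Integrable u mu := integrable_of_continuous_compactSpace hu
    have iv : Integrable v mu := integrable_of_continuous_compactSpace hv
    have iphi : Integrable phi mu := integrable_of_continuous_compactSpace hphi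
    have hUint : ∫ x, U x ∂mu = (∫ x, u x ∂mu) - (∫ x, phi x ∂mu) + 1 := by
      have h := integral_add (μ := mu) (iu.sub iphi) (integrable_const (1 : ℝ))
      simpa [integral_sub iu iphi] using h
    have hVint : ∫ x, V x ∂mu = (∫ x, v x ∂mu) - ∫ x, phi x ∂mu := integral_sub iv iphi
    rw [integral_add i1 i2, hU, hV, hUint, hVint]
    ring
  rw [hsum]
  refine integral_mono (i1.add i2) (integrable_of_continuous_compactSpace
    (continuous_integral_of_compactSpace (f := fun x y => k x y * Real.exp (u x + v y))
      (by fun_prop))) fun x => ?_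
  have j1 : Integrable (fun y => P x y * U x) mu :=
    integrable_of_continuous_compactSpace (by fun_prop)
  have j2 : Integrable (fun y => P x y * V y) mu :=
    integrable_of_continuous_compactSpace (by fun_prop)
  simp only
  rw [← integral_add j1 j2]
  refine integral_mono (j1.add j2) (integrable_of_continuous_compactSpace (by fun_prop))
    fun y => ?_
  have hPpos : 0 ≤ P x y := by
    have := hpos x y
    positivity
  have hexp : k x y * Real.exp (u x + v y) = P x y * Real.exp (U x - 1 + V y) := by
    simp only [hP, mul_assoc, ← Real.exp_add]
    congr 2
    simp only [U, V]
    ring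
  simp only [hexp, ← mul_add]
  exact mul_le_mul_of_nonneg_left (by linarith [Real.add_one_le_exp (U x - 1 + V y)]) hPpos

end Kernel

/-- The value of the self-transport cost in terms of a symmetric Schrödinger potential. -/
theorem OTcost_self_eq {eps : ℝ} (heps : 0 < eps) {C : X → X → ℝ}
    (hC : Continuous (Function.uncurry C)) (hCsym : ∀ x y, C x y = C y x)
    {mu : Measure X} [IsProbabilityMeasure mu] {phi : X → ℝ} (hphi : Continuous phi)
    (hfix : ∀ x, ∫ y, Real.exp (-(C x y) / eps) * Real.exp (phi y) ∂mu = Real.exp (-phi x)) :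
    OTcost eps C mu mu = 2 * eps * ∫ x, phi x ∂mu := by
  set k : X → X → ℝ := fun x y => Real.exp (-(C x y) / eps) with hkdef
  have hk : Continuous (Function.uncurry k) := by fun_prop
  have hpos : ∀ x y, 0 < k x y := fun x y => Real.exp_pos _
  have hsymm : ∀ x y, k x y = k y x := fun x y => by simp only [hkdef, hCsym x y]
  have hD : ∀ f g : X → ℝ, Continuous f → Continuous g → Dfun eps C mu mu f g
      = (∫ x, f x ∂mu) + (∫ x, g x ∂mu) -
        eps * ((∫ x, ∫ y, k x y * Real.exp (f x / eps + g y / eps) ∂mu ∂mu) - 1) := by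
    intro f g hf hg
    have hrw : ∀ x, ∫ y, (Real.exp ((f x + g y - C x y) / eps) - 1) ∂mu
        = (∫ y, k x y * Real.exp (f x / eps + g y / eps) ∂mu) - 1 := fun x => by
      have : ∀ y, Real.exp ((f x + g y - C x y) / eps)
          = k x y * Real.exp (f x / eps + g y / eps) := fun y => by
        rw [hkdef, ← Real.exp_add]
        congr 1
        ring
      simp only [this]
      rw [integral_sub (integrable_of_continuous_compactSpace (by fun_prop)) (integrable_const _)]
      simp
    rw [Dfun]
    simp only [hrw]
    rw [integral_sub (integrable_of_continuous_compactSpace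
      (continuous_integral_of_compactSpace
        (f := fun x y => k x y * Real.exp (f x / eps + g y / eps)) (by fun_prop)))
      (integrable_const _)]
    simp
  refine IsGreatest.csSup_eq ⟨⟨fun x => eps * phi x, fun x => eps * phi x, by fun_prop,
    by fun_prop, ?_⟩, ?_⟩
  · have h1 : ∫ x, ∫ y, k x y * Real.exp (phi x + phi y) ∂mu ∂mu = 1 := by
      have h := integral_integral_schrodinger hfix fun _ => 1
      simp only [Real.exp_add, ← mul_assoc]
      simpa only [mul_one, integral_const, probReal_univ, smul_eq_mul] using h
    rw [hD _ _ (by fun_prop) (by fun_prop)]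
    simp only [mul_div_cancel_left₀ _ heps.ne', h1, integral_const_mul]
    ring
  · rintro _ ⟨f, g, hf, hg, rfl⟩
    rw [hD f g hf hg]
    have h := dual_le_of_schrodinger hk hpos hsymm hphi hfix (u := fun x => f x / eps)
      (v := fun x => g x / eps) (by fun_prop) (by fun_prop)
    have h' := mul_le_mul_of_nonneg_left h heps.le
    simp only [integral_div] at h'
    have e1 : eps * ((∫ x, f x ∂mu) / eps) = ∫ x, f x ∂mu := mul_div_cancel₀ _ heps.ne'
    have e2 : eps * ((∫ x, g x ∂mu) / eps) = ∫ x, g x ∂mu := mul_div_cancel₀ _ heps.ne'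
    linarith

/-- Strict maximality of the Schrödinger potential of `mu` among Schrödinger potentials. -/
theorem integral_schrodinger_lt {k : X → X → ℝ} (hk : Continuous (Function.uncurry k))
    (hpd : StrictPosDef k) (hsymm : ∀ x y, k x y = k y x)
    {mu nu : Measure X} [IsProbabilityMeasure mu] [IsProbabilityMeasure nu] (hne : mu ≠ nu)
    {phi psi : X → ℝ} (hphi : Continuous phi) (hpsi : Continuous psi)
    (hphi_fix : ∀ x, ∫ y, k x y * Real.exp (phi y) ∂mu = Real.exp (-phi x))
    (hpsi_fix : ∀ x, ∫ y, k x y * Real.exp (psi y) ∂nu = Real.exp (-psi x)) :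
    ∫ x, phi x ∂mu < ∫ x, psi x ∂mu := by
  set mu' := mu.withDensity fun x => ENNReal.ofReal (Real.exp (phi x)) with hmu'
  set nu' := nu.withDensity fun x => ENNReal.ofReal (Real.exp (psi x)) with hnu'
  have fin : ∀ (m : Measure X) [IsProbabilityMeasure m] (f : X → ℝ), Continuous f →
      IsFiniteMeasure (m.withDensity fun x => ENNReal.ofReal (Real.exp (f x))) :=
    fun m _ f hf => isFiniteMeasure_withDensity_ofReal
      (integrable_of_continuous_compactSpace (by fun_prop)).2
  have hfm : IsFiniteMeasure mu' := fin mu phi hphi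
  have hfn : IsFiniteMeasure nu' := fin nu psi hpsi
  have hKmu : ∀ x, ∫ y, k x y ∂mu' = Real.exp (-phi x) := fun x => by
    rw [hmu', integral_withDensity_ofReal_exp hphi, hphi_fix]
  have hKnu : ∀ x, ∫ y, k x y ∂nu' = Real.exp (-psi x) := fun x => by
    rw [hnu', integral_withDensity_ofReal_exp hpsi, hpsi_fix]
  have hne' : mu' ≠ nu' := fun h => hne <| by
    have hpp : phi = psi := funext fun x => by
      have := hKmu x
      rw [h, hKnu] at this
      simpa using this.symm
    have inv : ∀ (m : Measure X), ((m.withDensity fun x => ENNReal.ofReal (Real.exp (phi x)))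
        |>.withDensity fun x => (ENNReal.ofReal (Real.exp (phi x)))⁻¹) = m := fun m =>
      withDensity_inv_same (by fun_prop) (.of_forall fun x => by simp [Real.exp_pos])
        (.of_forall fun x => ENNReal.ofReal_ne_top)
    rw [← inv mu, ← hmu', h, hnu', ← hpp, inv]
  have hq := hpd mu' nu' hfm hfn hne'
  have hswap : ∫ x, ∫ y, k x y ∂mu' ∂nu' = ∫ x, ∫ y, k x y ∂nu' ∂mu' := by
    rw [integral_integral_swap_of_hasCompactSupport hk (HasCompactSupport.of_compactSpace _)]
    simp only [hsymm]
  have hmm : ∫ x, ∫ y, k x y ∂mu' ∂mu' = 1 := by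
    simp only [hKmu]
    rw [hmu', integral_withDensity_ofReal_exp hphi]
    simp [← Real.exp_add]
  have hnn : ∫ x, ∫ y, k x y ∂nu' ∂nu' = 1 := by
    simp only [hKnu]
    rw [hnu', integral_withDensity_ofReal_exp hpsi]
    simp [← Real.exp_add]
  have hmn : ∫ x, ∫ y, k x y ∂nu' ∂mu' = ∫ x, Real.exp (phi x - psi x) ∂mu := by
    simp only [hKnu]
    rw [hmu', integral_withDensity_ofReal_exp hphi]
    simp only [← Real.exp_add, neg_add_eq_sub]
  rw [kerQuad, hswap, hmm, hnn, hmn] at hq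
  have iphi : Integrable phi mu := integrable_of_continuous_compactSpace hphi
  have ipsi : Integrable psi mu := integrable_of_continuous_compactSpace hpsi
  have hle : ∫ x, (phi x - psi x + 1) ∂mu ≤ ∫ x, Real.exp (phi x - psi x) ∂mu :=
    integral_mono ((iphi.sub ipsi).add (integrable_const _))
      (integrable_of_continuous_compactSpace (by fun_prop)) fun x => Real.add_one_le_exp _
  have hint_eq : ∫ x, (phi x - psi x + 1) ∂mu = (∫ x, phi x ∂mu) - (∫ x, psi x ∂mu) + 1 := by
    have h := integral_add (μ := mu) (iphi.sub ipsi) (integrable_const (1 : ℝ))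
    simpa [integral_sub iphi ipsi] using h
  linarith

end Compact

/-- If the Gibbs kernel `k_ε` is strictly positive definite, the
Sinkhorn negentropy `F_ε(α) = -½ OT_ε(α, α)` is strictly convex on probability
measures. -/
theorem sinkhorn_negentropy_strictly_convex
    {X : Type*} [MetricSpace X] [CompactSpace X] [MeasurableSpace X] [BorelSpace X]
    (eps : ℝ) (heps : 0 < eps) (C : X → X → ℝ) (kappa : ℝ≥0) (hkappa : 0 < kappa)
    (hCsym : ∀ x y, C x y = C y x)
    (hClip1 : ∀ y, LipschitzWith kappa (fun x => C x y))
    (hClip2 : ∀ x, LipschitzWith kappa (fun y => C x y))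
    (hpd : StrictPosDef (fun x y => Real.exp (-(C x y) / eps)))
    (alpha0 alpha1 : Measure X) [IsProbabilityMeasure alpha0] [IsProbabilityMeasure alpha1]
    (hne : alpha0 ≠ alpha1) (t : ℝ) (ht0 : 0 < t) (ht1 : t < 1) :
    -(1/2) * OTcost eps C
        (ENNReal.ofReal (1 - t) • alpha0 + ENNReal.ofReal t • alpha1)
        (ENNReal.ofReal (1 - t) • alpha0 + ENNReal.ofReal t • alpha1)
      < (1 - t) * (-(1/2) * OTcost eps C alpha0 alpha0)
        + t * (-(1/2) * OTcost eps C alpha1 alpha1) := by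
  have hC : Continuous (Function.uncurry C) := (LipschitzWith.uncurry hClip1 hClip2).continuous
  set k : X → X → ℝ := fun x y => Real.exp (-(C x y) / eps) with hkdef
  have hk : Continuous (Function.uncurry k) := by fun_prop
  have hpos : ∀ x y, 0 < k x y := fun x y => Real.exp_pos _
  have hsymm : ∀ x y, k x y = k y x := fun x y => by simp only [hkdef, hCsym x y]
  set beta := ENNReal.ofReal (1 - t) • alpha0 + ENNReal.ofReal t • alpha1 with hbeta
  have hprob : IsProbabilityMeasure beta := ⟨by
    simp only [hbeta, Measure.add_apply, Measure.smul_apply, measure_univ, smul_eq_mul, mul_one]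
    rw [← ENNReal.ofReal_add (by linarith) ht0.le]
    simp⟩
  obtain ⟨phi0, hphi0, hfix0⟩ := exists_schrodinger_potential hk hpos alpha0
  obtain ⟨phi1, hphi1, hfix1⟩ := exists_schrodinger_potential hk hpos alpha1
  obtain ⟨psi, hpsi, hfix⟩ := exists_schrodinger_potential hk hpos beta
  rw [OTcost_self_eq heps hC hCsym hpsi hfix, OTcost_self_eq heps hC hCsym hphi0 hfix0,
    OTcost_self_eq heps hC hCsym hphi1 hfix1]
  have hint_eq : ∫ x, psi x ∂beta = (1 - t) * ∫ x, psi x ∂alpha0 + t * ∫ x, psi x ∂alpha1 := by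
    rw [hbeta, integral_add_measure
      ((integrable_of_continuous_compactSpace hpsi).smul_measure ENNReal.ofReal_ne_top)
      ((integrable_of_continuous_compactSpace hpsi).smul_measure ENNReal.ofReal_ne_top),
      integral_smul_measure, integral_smul_measure, ENNReal.toReal_ofReal (by linarith),
      ENNReal.toReal_ofReal ht0.le, smul_eq_mul, smul_eq_mul]
  have hreal : ∀ s, beta.real s = (1 - t) * alpha0.real s + t * alpha1.real s := fun s => by
    rw [hbeta, measureReal_add_apply
        (by simpa using ENNReal.mul_ne_top ENNReal.ofReal_ne_top (measure_ne_top alpha0 s))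
        (by simpa using ENNReal.mul_ne_top ENNReal.ofReal_ne_top (measure_ne_top alpha1 s)),
      measureReal_ennreal_smul_apply,
      measureReal_ennreal_smul_apply, ENNReal.toReal_ofReal (by linarith),
      ENNReal.toReal_ofReal ht0.le]
  have hne0 : alpha0 ≠ beta := fun h => hne <| Measure.ext fun s _ => by
    have hs := hreal s
    rw [← h] at hs
    rw [← measureReal_eq_measureReal_iff]
    exact mul_left_cancel₀ ht0.ne' (by linarith)
  have hne1 : alpha1 ≠ beta := fun h => hne <| Measure.ext fun s _ => by
    have hs := hreal s
    rw [← h] at hs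
    rw [← measureReal_eq_measureReal_iff]
    exact mul_left_cancel₀ (sub_pos.2 ht1).ne' (by linarith)
  have h0 := integral_schrodinger_lt hk hpd hsymm hne0 hphi0 hpsi hfix0 hfix
  have h1 := integral_schrodinger_lt hk hpd hsymm hne1 hphi1 hpsi hfix1 hfix
  rw [hint_eq]
  have h0' := mul_lt_mul_of_pos_left h0 (mul_pos heps (sub_pos.2 ht1))
  have h1' := mul_lt_mul_of_pos_left h1 (mul_pos heps ht0)
  linarith
end

section
/- Let α and β be Borel probability measures on X, and let (f₀, g₀) and (f₁, g₁) be two pairs of continuous functions on X satisfying the fixed-point optimality equations fᵢ = T_ε(β, gᵢ) and gᵢ = T_ε(α, fᵢ) on all of X (i = 0, 1), and both maximizing the dual functional, i.e. D_ε(α, β; f₀, g₀) = D_ε(α, β; f₁, g₁) = OT_ε(α, β). Then there exists a constant K ∈ ℝ such that f₁ = f₀ + K and g₁ = g₀ − K on all of X. -/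
open MeasureTheory Real Filter Topology
open scoped NNReal ENNReal

/-- The Sinkhorn map `T_ε(α, f)(y) = -ε log ∫ exp((f(x) - C(x,y))/ε) dα(x)`. -/
noncomputable def Tmap {X : Type*} [MeasurableSpace X] (eps : ℝ) (C : X → X → ℝ)
    (alpha : Measure X) (f : X → ℝ) : X → ℝ :=
  fun y => -eps * Real.log (∫ x, Real.exp ((f x - C x y) / eps) ∂alpha)

/-- The Gibbs integrand of the Sinkhorn map is integrable for continuous data. -/
theorem integrable_exp_sub_div {X : Type*} [TopologicalSpace X] [CompactSpace X]
    [MeasurableSpace X] [BorelSpace X] (eps : ℝ) {c f : X → ℝ} (hc : Continuous c)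
    (hf : Continuous f) (mu : Measure X) [IsFiniteMeasure mu] :
    Integrable (fun x => Real.exp ((f x - c x) / eps)) mu := by
  have h : Continuous fun x => Real.exp ((f x - c x) / eps) := by fun_prop
  exact h.integrable_of_hasCompactSupport (HasCompactSupport.of_compactSpace _)

/-- The Sinkhorn map turns the addition of a constant into its subtraction. -/
theorem Tmap_add_const {X : Type*} [TopologicalSpace X] [CompactSpace X]
    [MeasurableSpace X] [BorelSpace X] {eps : ℝ} (heps : 0 < eps) {C : X → X → ℝ}
    (hC : ∀ y, Continuous fun x => C x y) (mu : Measure X) [IsProbabilityMeasure mu]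
    {f : X → ℝ} (hf : Continuous f) (K : ℝ) (y : X) :
    Tmap eps C mu (fun x => f x + K) y = Tmap eps C mu f y - K := by
  have hpos := integral_exp_pos (integrable_exp_sub_div eps (hC y) hf mu)
  have hsplit : (fun x => Real.exp ((f x + K - C x y) / eps)) =
      fun x => Real.exp (K / eps) * Real.exp ((f x - C x y) / eps) := by
    funext x
    rw [← Real.exp_add]
    congr 1
    ring
  unfold Tmap
  rw [hsplit, integral_const_mul, Real.log_mul (Real.exp_pos _).ne' hpos.ne', Real.log_exp]
  field_simp
  ring

/-- The Sinkhorn map is order reversing. -/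
theorem Tmap_le_Tmap {X : Type*} [TopologicalSpace X] [CompactSpace X]
    [MeasurableSpace X] [BorelSpace X] {eps : ℝ} (heps : 0 < eps) {C : X → X → ℝ}
    (hC : ∀ y, Continuous fun x => C x y) (mu : Measure X) [IsProbabilityMeasure mu]
    {f g : X → ℝ} (hf : Continuous f) (hg : Continuous g) (hfg : ∀ x, f x ≤ g x) (y : X) :
    Tmap eps C mu g y ≤ Tmap eps C mu f y := by
  have hif := integrable_exp_sub_div eps (hC y) hf mu
  have hig := integrable_exp_sub_div eps (hC y) hg mu
  have hle := Real.log_le_log (integral_exp_pos hif) (integral_mono hif hig fun x =>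
    Real.exp_le_exp.2 (div_le_div_of_nonneg_right (sub_le_sub_right (hfg x) _) heps.le))
  unfold Tmap
  nlinarith

/-- If two ordered potentials have the same Sinkhorn image at one point, they agree
almost everywhere. -/
theorem ae_eq_of_Tmap_eq {X : Type*} [TopologicalSpace X] [CompactSpace X]
    [MeasurableSpace X] [BorelSpace X] {eps : ℝ} (heps : 0 < eps) {C : X → X → ℝ}
    (hC : ∀ y, Continuous fun x => C x y) (mu : Measure X) [IsProbabilityMeasure mu]
    {f g : X → ℝ} (hf : Continuous f) (hg : Continuous g) (hfg : ∀ x, f x ≤ g x) {y : X}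
    (h : Tmap eps C mu f y = Tmap eps C mu g y) : f =ᵐ[mu] g := by
  have hif := integrable_exp_sub_div eps (hC y) hf mu
  have hig := integrable_exp_sub_div eps (hC y) hg mu
  have hint := Real.log_injOn_pos (integral_exp_pos hif) (integral_exp_pos hig)
    (mul_left_cancel₀ (neg_ne_zero.2 heps.ne') h)
  have hle : (fun x => Real.exp ((f x - C x y) / eps)) ≤ᵐ[mu]
      fun x => Real.exp ((g x - C x y) / eps) := .of_forall fun x =>
    Real.exp_le_exp.2 (div_le_div_of_nonneg_right (sub_le_sub_right (hfg x) _) heps.le)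
  filter_upwards [(integral_eq_iff_of_ae_le hif hig hle).1 hint] with x hx
  exact sub_left_injective ((div_left_inj' heps.ne').1 (Real.exp_injective hx))

/-- The Sinkhorn map only depends on the almost everywhere class of the potential. -/
theorem Tmap_congr_ae {X : Type*} [MeasurableSpace X] (eps : ℝ) (C : X → X → ℝ)
    {mu : Measure X} {f g : X → ℝ} (h : f =ᵐ[mu] g) : Tmap eps C mu f = Tmap eps C mu g := by
  funext y
  unfold Tmap
  congr 2
  refine integral_congr_ae ?_
  filter_upwards [h] with x hx
  rw [hx]

/-- Two pairs of continuous dual potentials that satisfy the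
Sinkhorn fixed-point equations on all of `X` and both maximize the dual
functional differ by an additive constant: `f₁ = f₀ + K`, `g₁ = g₀ - K`. -/
theorem dual_potentials_unique_up_to_constant
    {X : Type*} [MetricSpace X] [CompactSpace X] [MeasurableSpace X] [BorelSpace X]
    (eps : ℝ) (heps : 0 < eps) (C : X → X → ℝ) (kappa : ℝ≥0) (hkappa : 0 < kappa)
    (hCsym : ∀ x y, C x y = C y x)
    (hClip1 : ∀ y, LipschitzWith kappa (fun x => C x y))
    (hClip2 : ∀ x, LipschitzWith kappa (fun y => C x y))
    (alpha beta : Measure X) [IsProbabilityMeasure alpha] [IsProbabilityMeasure beta]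
    (f0 g0 f1 g1 : X → ℝ)
    (hf0 : Continuous f0) (hg0 : Continuous g0) (hf1 : Continuous f1) (hg1 : Continuous g1)
    (hfix0f : f0 = Tmap eps C beta g0) (hfix0g : g0 = Tmap eps C alpha f0)
    (hfix1f : f1 = Tmap eps C beta g1) (hfix1g : g1 = Tmap eps C alpha f1)
    (hopt0 : Dfun eps C alpha beta f0 g0 = OTcost eps C alpha beta)
    (hopt1 : Dfun eps C alpha beta f1 g1 = OTcost eps C alpha beta) :
    ∃ K : ℝ, (∀ x, f1 x = f0 x + K) ∧ (∀ x, g1 x = g0 x - K) := by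
  have hC : ∀ y, Continuous fun x => C x y := fun y => (hClip1 y).continuous
  have : Nonempty X := nonempty_of_isProbabilityMeasure alpha
  obtain ⟨x₀, -, hmax⟩ := isCompact_univ.exists_isMaxOn Set.univ_nonempty
    (hf1.sub hf0).continuousOn
  set K : ℝ := f1 x₀ - f0 x₀ with hK
  have hf_le : ∀ x, f1 x ≤ f0 x + K := fun x => by
    have : f1 x - f0 x ≤ f1 x₀ - f0 x₀ := hmax (Set.mem_univ x)
    linarith
  have hTf : ∀ y, Tmap eps C alpha (fun x => f0 x + K) y = g0 y - K := fun y => by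
    rw [Tmap_add_const heps hC alpha hf0, ← hfix0g]
  have hTg : ∀ x, Tmap eps C beta (fun y => g0 y + -K) x = f0 x + K := fun x => by
    rw [Tmap_add_const heps hC beta hg0, ← hfix0f, sub_neg_eq_add]
  have hf0K : Continuous fun x => f0 x + K := by fun_prop
  have hg0K : Continuous fun y => g0 y + -K := by fun_prop
  have hg_le : ∀ y, g0 y + -K ≤ g1 y := fun y => by
    have := Tmap_le_Tmap heps hC alpha hf1 hf0K hf_le y
    rw [hTf, ← hfix1g] at this
    linarith
  have hg_ae : (fun y => g0 y + -K) =ᵐ[beta] g1 :=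
    ae_eq_of_Tmap_eq heps hC beta hg0K hg1 hg_le (y := x₀) (by
      rw [hTg, ← hfix1f, hK]
      ring)
  have hf_eq : ∀ x, f1 x = f0 x + K := fun x => by
    rw [← hTg, Tmap_congr_ae eps C hg_ae, ← hfix1f]
  refine ⟨K, hf_eq, fun y => ?_⟩
  rw [← hTf, ← funext hf_eq, ← hfix1g]
end
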